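/- Let C_0 ⊆ F_2^n be a binary code and C = Span{d(F_2^n), e(C_0)} ⊆ F_2^{2n}. Then the stabilizer of the subcode d(F_2^n) in Aut(C) is isomorphic to the wreath product Z_2 ≀ Aut(C_0) (of order 2^n · |Aut(C_0)|). -/

import Mathlib

/-- Hamming weight of a binary word. -/
def wt {n : ℕ} (v : Fin n → ZMod 2) : ℕ :=
  (Finset.univ.filter (fun i => v i ≠ 0)).card

/-- Size of the intersection of the supports of two binary words. -/
def interCard {n : ℕ} (v w : Fin n → ZMod 2) : ℕ :=
  (Finset.univ.filter (fun i => v i ≠ 0 ∧ w i ≠ 0)).card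

/-- The doubling map `d : F₂ⁿ → F₂^{2n}`, `(c₁,…,cₙ) ↦ (c₁,c₁,c₂,c₂,…,cₙ,cₙ)`. -/
def dbl {n : ℕ} (c : Fin n → ZMod 2) : Fin (2 * n) → ZMod 2 :=
  fun i => c ⟨(i : ℕ) / 2, by have := i.isLt; omega⟩

/-- The map `e : F₂ⁿ → F₂^{2n}`, `(c₁,…,cₙ) ↦ (0,c₁,0,c₂,…,0,cₙ)`. -/
def emap {n : ℕ} (c : Fin n → ZMod 2) : Fin (2 * n) → ZMod 2 :=
  fun i => if (i : ℕ) % 2 = 1 then c ⟨(i : ℕ) / 2, by have := i.isLt; omega⟩ else 0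

/-- The even-weight code `𝓔ₙ ⊆ F₂ⁿ`. -/
def evenCode (n : ℕ) : Set (Fin n → ZMod 2) := {c | Even (wt c)}

/-- Coordinates of the doubled word, grouped in pairs. -/
def pairE (n : ℕ) : Fin n × Bool ≃ Fin (2 * n) where
  toFun p := ⟨2 * (p.1 : ℕ) + p.2.toNat, by
    have := p.1.isLt
    have := Bool.toNat_le p.2
    omega⟩
  invFun i := (⟨(i : ℕ) / 2, by have := i.isLt; omega⟩, decide ((i : ℕ) % 2 = 1))
  left_inv := by
    rintro ⟨j, b⟩
    cases b
    · ext <;> simp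
    · ext
      · simp; omega
      · simp
  right_inv := by
    intro i
    apply Fin.ext
    simp only
    by_cases h : (i : ℕ) % 2 = 1
    · simp only [h, decide_true, Bool.toNat_true]; omega
    · simp only [h, decide_false, Bool.toNat_false]; omega

/-- The pair-sum of a word. -/
def psum {n : ℕ} (v : Fin (2 * n) → ZMod 2) : Fin n → ZMod 2 :=
  fun j => v (pairE n (j, false)) + v (pairE n (j, true))

lemma dbl_pairE {n : ℕ} (c : Fin n → ZMod 2) (p : Fin n × Bool) :
    dbl c (pairE n p) = c p.1 := by
  have h : ((pairE n).symm (pairE n p)).1 = p.1 := by simp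
  exact congrArg c h

lemma emap_pairE {n : ℕ} (c : Fin n → ZMod 2) (p : Fin n × Bool) :
    emap c (pairE n p) = if p.2 = true then c p.1 else 0 := by
  have h : ((pairE n).symm (pairE n p)) = p := by simp
  have h1 : ((pairE n).symm (pairE n p)).1 = p.1 := by simp
  have h2 : decide (((pairE n p : Fin (2 * n)) : ℕ) % 2 = 1) = p.2 := congrArg Prod.snd h
  have h3 : (((pairE n p : Fin (2 * n)) : ℕ) % 2 = 1) ↔ p.2 = true := by
    rw [← h2]; simp
  unfold emap
  simp only [h3]
  split_ifs
  · exact congrArg c h1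
  · rfl

lemma ext_pairE {n : ℕ} {v w : Fin (2 * n) → ZMod 2}
    (h : ∀ p, v (pairE n p) = w (pairE n p)) : v = w := by
  funext i
  have := h ((pairE n).symm i)
  simpa using this

lemma zmod2_add_eq_zero (a b : ZMod 2) : a + b = 0 ↔ a = b := by
  revert a b; decide

lemma psum_dbl {n : ℕ} (c : Fin n → ZMod 2) : psum (dbl c) = 0 := by
  funext j
  simp only [psum, dbl_pairE, Pi.zero_apply]
  exact (zmod2_add_eq_zero _ _).2 rfl

lemma psum_emap {n : ℕ} (c : Fin n → ZMod 2) : psum (emap c) = c := by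
  funext j
  simp [psum, emap_pairE]

lemma psum_add {n : ℕ} (v w : Fin (2 * n) → ZMod 2) : psum (v + w) = psum v + psum w := by
  funext j
  simp only [psum, Pi.add_apply]
  ring

lemma psum_smul {n : ℕ} (a : ZMod 2) (v : Fin (2 * n) → ZMod 2) :
    psum (a • v) = a • psum v := by
  funext j
  simp only [psum, Pi.smul_apply, smul_eq_mul]
  ring

lemma psum_zero {n : ℕ} : psum (0 : Fin (2 * n) → ZMod 2) = 0 := by
  funext j
  simp [psum]

lemma decomp {n : ℕ} (v : Fin (2 * n) → ZMod 2) :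
    v = dbl (fun j => v (pairE n (j, false))) + emap (psum v) := by
  apply ext_pairE
  rintro ⟨j, b⟩
  simp only [Pi.add_apply, dbl_pairE, emap_pairE, psum]
  cases b
  · simp
  · simp only [if_true]
    generalize v (pairE n (j, false)) = a
    generalize v (pairE n (j, true)) = b
    revert a b; decide

lemma mem_range_dbl {n : ℕ} (v : Fin (2 * n) → ZMod 2) :
    v ∈ Set.range (dbl (n := n)) ↔ psum v = 0 := by
  constructor
  · rintro ⟨c, rfl⟩
    exact psum_dbl c
  · intro h
    refine ⟨fun j => v (pairE n (j, false)), ?_⟩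
    have h2 := decomp v
    rw [h] at h2
    have h3 : emap (0 : Fin n → ZMod 2) = 0 := by
      funext i; simp [emap]
    rw [h3, add_zero] at h2
    exact h2.symm

lemma mem_C {n : ℕ} (C₀ : Submodule (ZMod 2) (Fin n → ZMod 2)) (v : Fin (2 * n) → ZMod 2) :
    v ∈ Submodule.span (ZMod 2) (Set.range (dbl (n := n)) ∪ emap '' C₀) ↔ psum v ∈ C₀ := by
  constructor
  · intro h
    induction h using Submodule.span_induction with
    | mem x hx =>
      rcases hx with ⟨c, rfl⟩ | ⟨c, hc, rfl⟩
      · rw [psum_dbl]; exact C₀.zero_mem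
      · rw [psum_emap]; exact hc
    | zero => rw [psum_zero]; exact C₀.zero_mem
    | add x y _ _ hx hy => rw [psum_add]; exact C₀.add_mem hx hy
    | smul a x _ hx => rw [psum_smul]; exact C₀.smul_mem a hx
  · intro h
    rw [decomp v]
    exact Submodule.add_mem _ (Submodule.subset_span (Or.inl ⟨_, rfl⟩))
      (Submodule.subset_span (Or.inr ⟨_, h, rfl⟩))

/-- index of the pair containing a coordinate -/
def pr {n : ℕ} (i : Fin (2 * n)) : Fin n := ((pairE n).symm i).1

lemma pr_pairE {n : ℕ} (p : Fin n × Bool) : pr (pairE n p) = p.1 := by simp [pr]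

/-- If `σ` lies over `τ`, the pair-sum is equivariant. -/
lemma sigma_form {n : ℕ} (σ : Equiv.Perm (Fin (2 * n))) (τ : Equiv.Perm (Fin n))
    (h : ∀ i, pr (σ i) = τ (pr i)) (j : Fin n) : ∃ f : Bool, ∀ b,
      σ (pairE n (j, b)) = pairE n (τ j, xor b f) := by
  have key : ∀ b, σ (pairE n (j, b)) = pairE n (τ j, ((pairE n).symm (σ (pairE n (j, b)))).2) := by
    intro b
    have h1 := h (pairE n (j, b))
    rw [pr_pairE] at h1
    rw [← Equiv.symm_apply_eq]
    exact Prod.ext h1 rfl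
  refine ⟨((pairE n).symm (σ (pairE n (j, false)))).2, ?_⟩
  have hne : ((pairE n).symm (σ (pairE n (j, true)))).2
      ≠ ((pairE n).symm (σ (pairE n (j, false)))).2 := by
    intro he
    have h2 : σ (pairE n (j, true)) = σ (pairE n (j, false)) := by
      rw [key true, key false, he]
    have := (pairE n).injective (σ.injective h2)
    simp at this
  intro b
  rw [key b]
  congr 2
  revert hne
  cases b
  · simp
  · simp only [Bool.true_xor]
    generalize ((pairE n).symm (σ (pairE n (j, true)))).2 = x
    generalize ((pairE n).symm (σ (pairE n (j, false)))).2 = y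
    revert x y; decide

lemma psum_comp {n : ℕ} (σ : Equiv.Perm (Fin (2 * n))) (τ : Equiv.Perm (Fin n))
    (h : ∀ i, pr (σ i) = τ (pr i)) (v : Fin (2 * n) → ZMod 2) :
    psum (v ∘ σ) = psum v ∘ τ := by
  funext j
  obtain ⟨f, hf⟩ := sigma_form σ τ h j
  simp only [psum, Function.comp_apply, hf]
  cases f
  · simp
  · simp [add_comm]

lemma exists_tau {n : ℕ} (σ : Equiv.Perm (Fin (2 * n)))
    (h : ∀ v : Fin (2 * n) → ZMod 2, psum v = 0 → psum (v ∘ σ) = 0) :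
    ∃ τ : Equiv.Perm (Fin n), ∀ i, pr (σ i) = τ (pr i) := by
  have h1 : ∀ j, pr (σ (pairE n (j, true))) = pr (σ (pairE n (j, false))) := by
    intro j
    have h2 := congrFun (h (dbl (fun k => if k = pr (σ (pairE n (j, false))) then 1 else 0))
      (psum_dbl _)) j
    have h3 : ∀ (c : Fin n → ZMod 2) i, dbl c i = c (pr i) := fun c i => rfl
    simp only [psum, Function.comp_apply, h3, Pi.zero_apply, if_true] at h2
    by_contra hc
    simp [hc] at h2
  have h2 : ∀ i, pr (σ i) = pr (σ (pairE n (pr i, false))) := by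
    intro i
    obtain ⟨⟨j, b⟩, rfl⟩ := (pairE n).surjective i
    rw [pr_pairE]
    cases b
    · rfl
    · exact h1 j
  have hs : Function.Surjective (fun j => pr (σ (pairE n (j, false)))) := by
    intro k
    refine ⟨pr (σ.symm (pairE n (k, false))), ?_⟩
    simp only
    rw [← h2, Equiv.apply_symm_apply, pr_pairE]
  exact ⟨Equiv.ofBijective _ (Finite.injective_iff_bijective.1
    (Finite.injective_iff_surjective.2 hs)), h2⟩

/-- The permutation of coordinates given by a wreath product element. -/
def wrMk (n : ℕ) (x : (Fin n → Bool) × Equiv.Perm (Fin n)) : Equiv.Perm (Fin (2 * n)) :=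
  (pairE n).permCongr
    { toFun := fun p => (x.2 p.1, xor p.2 (x.1 p.1))
      invFun := fun p => (x.2.symm p.1, xor p.2 (x.1 (x.2.symm p.1)))
      left_inv := by rintro ⟨j, b⟩; simp
      right_inv := by rintro ⟨j, b⟩; simp }

lemma wrMk_pairE {n : ℕ} (x : (Fin n → Bool) × Equiv.Perm (Fin n)) (j : Fin n) (b : Bool) :
    wrMk n x (pairE n (j, b)) = pairE n (x.2 j, xor b (x.1 j)) := by
  simp [wrMk, Equiv.permCongr_apply]

lemma wrMk_injective (n : ℕ) : Function.Injective (wrMk n) := by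
  rintro ⟨f, τ⟩ ⟨g, ρ⟩ h
  have h1 : ∀ j, τ j = ρ j ∧ f j = g j := by
    intro j
    have h2 := congrArg (fun σ : Equiv.Perm (Fin (2 * n)) => σ (pairE n (j, false))) h
    simp only [wrMk_pairE] at h2
    have h3 := (pairE n).injective h2
    simpa using h3
  exact Prod.ext (funext fun j => (h1 j).2) (Equiv.ext fun j => (h1 j).1)

lemma wr_eq_image {n : ℕ} (A : Set (Equiv.Perm (Fin n))) :
    {σ : Equiv.Perm (Fin (2 * n)) | ∃ τ ∈ A, ∀ i, pr (σ i) = τ (pr i)}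
      = wrMk n '' (Set.univ ×ˢ A) := by
  ext σ
  constructor
  · rintro ⟨τ, hτ, h⟩
    choose f hf using sigma_form σ τ h
    refine ⟨(f, τ), ⟨trivial, hτ⟩, ?_⟩
    ext1 i
    obtain ⟨⟨j, b⟩, rfl⟩ := (pairE n).surjective i
    rw [wrMk_pairE, hf]
  · rintro ⟨⟨f, τ⟩, ⟨-, hτ⟩, rfl⟩
    refine ⟨τ, hτ, fun i => ?_⟩
    obtain ⟨⟨j, b⟩, rfl⟩ := (pairE n).surjective i
    rw [wrMk_pairE, pr_pairE, pr_pairE]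

/-- for `C = Span{d(F₂ⁿ), e(C₀)} ⊆ F₂^{2n}`, the stabilizer of the
subcode `d(F₂ⁿ)` in `Aut(C)` is (isomorphic to) the wreath product `ℤ₂ ≀ Aut(C₀)`,
realized concretely as the group of coordinate permutations that preserve the `n`
pairs of coordinates and induce on the pairs an automorphism of `C₀`; in particular
its order is `2ⁿ · |Aut(C₀)|`. -/
theorem stabilizer_dbl_eq_wreath (n : ℕ)
    (C₀ : Submodule (ZMod 2) (Fin n → ZMod 2)) :
    let C : Set (Fin (2 * n) → ZMod 2) :=
      ↑(Submodule.span (ZMod 2) (Set.range (dbl (n := n)) ∪ emap '' C₀))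
    let Stab : Set (Equiv.Perm (Fin (2 * n))) :=
      {σ | (∀ v : Fin (2 * n) → ZMod 2, v ∈ C ↔ v ∘ σ ∈ C) ∧
           (∀ v : Fin (2 * n) → ZMod 2,
             v ∈ Set.range (dbl (n := n)) ↔ v ∘ σ ∈ Set.range (dbl (n := n)))}
    let Wr : Set (Equiv.Perm (Fin (2 * n))) :=
      {σ | ∃ τ : Equiv.Perm (Fin n),
        (∀ y : Fin n → ZMod 2, y ∈ C₀ ↔ y ∘ τ ∈ C₀) ∧
        (∀ i : Fin (2 * n),
          ((σ i : ℕ)) / 2 = ((τ ⟨(i : ℕ) / 2, by have := i.isLt; omega⟩ : Fin n) : ℕ))}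
    Stab = Wr ∧
    Nat.card Stab =
      2 ^ n * Nat.card {τ : Equiv.Perm (Fin n) | ∀ y : Fin n → ZMod 2, y ∈ C₀ ↔ y ∘ τ ∈ C₀} := by
  intro C Stab Wr
  have hWr : Wr = {σ : Equiv.Perm (Fin (2 * n)) |
      ∃ τ ∈ {τ : Equiv.Perm (Fin n) | ∀ y : Fin n → ZMod 2, y ∈ C₀ ↔ y ∘ τ ∈ C₀},
        ∀ i, pr (σ i) = τ (pr i)} := by
    ext σ
    constructor
    · rintro ⟨τ, hτ, h⟩
      exact ⟨τ, hτ, fun i => Fin.ext (h i)⟩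
    · rintro ⟨τ, hτ, h⟩
      exact ⟨τ, hτ, fun i => congrArg Fin.val (h i)⟩
  have hC : ∀ v, v ∈ C ↔ psum v ∈ C₀ := mem_C C₀
  have hEq : Stab = Wr := by
    rw [hWr]
    ext σ
    constructor
    · rintro ⟨h1, h2⟩
      simp only [mem_range_dbl] at h2
      obtain ⟨τ, hτ⟩ := exists_tau σ (fun v => (h2 v).1)
      refine ⟨τ, fun y => ?_, hτ⟩
      have h3 := h1 (emap y)
      rwa [hC, hC, psum_comp σ τ hτ, psum_emap] at h3
    · rintro ⟨τ, hA, hτ⟩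
      refine ⟨fun v => ?_, fun v => ?_⟩
      · rw [hC, hC, psum_comp σ τ hτ]
        exact hA _
      · rw [mem_range_dbl, mem_range_dbl, psum_comp σ τ hτ]
        constructor
        · intro h
          rw [h]; rfl
        · intro h
          funext j
          have := congrFun h (τ.symm j)
          simpa using this
  refine ⟨hEq, ?_⟩
  rw [hEq, hWr, wr_eq_image, Nat.card_image_of_injective (wrMk_injective n),
    Nat.card_congr (Equiv.Set.prod _ _), Nat.card_prod]
  simp
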